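/- Let p ≥ 3 be an odd integer and let T̂ = T + E ∈ ⊗^p ℝ^n, where T = Σ_{i=1}^n λ_i v_i^⊗p is SOD with λ_i > 0 for all i, {v₁,…,v_n} an orthonormal basis of ℝ^n, and E is a symmetric tensor with operator norm ε := ‖E‖. Let x̂ be a maximizer of T̂ x^⊗p over unit vectors x, set x_i := ⟨v_i, x̂⟩, and let j maximize λ_i |x_i|^{p−2}. Then ‖Σ_{i≠j} λ_i x_i^{p−1} v_i‖₂ ≤ 4ε(1 + 2ε/λ_j). -/

import Mathlib

open scoped RealInnerProductSpace BigOperators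

/-- The symmetric rank-one tensor `v^⊗p`, with entries `v_{i₁} ⋯ v_{i_p}`. -/
noncomputable def tpow {n : ℕ} (p : ℕ) (v : EuclideanSpace ℝ (Fin n)) : (Fin p → Fin n) → ℝ :=
  fun idx => ∏ k, v (idx k)

/-- `T x^⊗p = ∑_{i₁,…,i_p} T_{i₁,…,i_p} x_{i₁} ⋯ x_{i_p}`. -/
noncomputable def tapply {p n : ℕ} (T : (Fin p → Fin n) → ℝ) (x : EuclideanSpace ℝ (Fin n)) : ℝ :=
  ∑ idx : Fin p → Fin n, T idx * ∏ k, x (idx k)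

/-- A tensor is symmetric if its entries are invariant under all permutations of the indices. -/
def tsymm {p n : ℕ} (T : (Fin p → Fin n) → ℝ) : Prop :=
  ∀ (σ : Equiv.Perm (Fin p)) (idx : Fin p → Fin n), T (idx ∘ σ) = T idx

/-- Operator norm of a (symmetric) tensor: `sup_{‖x‖₂=1} |T x^⊗p|`. -/
noncomputable def tnorm {p n : ℕ} (T : (Fin p → Fin n) → ℝ) : ℝ :=
  sSup {r | ∃ x : EuclideanSpace ℝ (Fin n), ‖x‖ = 1 ∧ |tapply T x| = r}

theorem tapply_tpow {n : ℕ} (p : ℕ) (v x : EuclideanSpace ℝ (Fin n)) :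
    tapply (tpow p v) x = ⟪v, x⟫ ^ p := by
  have h : ⟪v, x⟫ = ∑ i, v i * x i := by
    simp [PiLp.inner_apply, mul_comm]
  rw [h, Fintype.sum_pow]
  simp [tapply, tpow, Finset.prod_mul_distrib]

theorem tapply_add {p n : ℕ} (S T : (Fin p → Fin n) → ℝ) (x : EuclideanSpace ℝ (Fin n)) :
    tapply (S + T) x = tapply S x + tapply T x := by
  simp [tapply, add_mul, Finset.sum_add_distrib]

theorem tapply_sum_smul_tpow {n m : ℕ} (p : ℕ) (c : Fin m → ℝ)
    (v : Fin m → EuclideanSpace ℝ (Fin n)) (x : EuclideanSpace ℝ (Fin n)) :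
    tapply (∑ i, c i • tpow p (v i)) x = ∑ i, c i * ⟪v i, x⟫ ^ p := by
  simp only [← tapply_tpow, tapply, Finset.sum_apply, Pi.smul_apply, smul_eq_mul,
    Finset.sum_mul, Finset.mul_sum, mul_assoc]
  exact Finset.sum_comm

theorem abs_tapply_le_tnorm {p n : ℕ} (T : (Fin p → Fin n) → ℝ)
    {x : EuclideanSpace ℝ (Fin n)} (hx : ‖x‖ = 1) : |tapply T x| ≤ tnorm T := by
  refine le_csSup ⟨∑ idx, |T idx|, ?_⟩ ⟨x, hx, rfl⟩
  rintro _ ⟨y, hy, rfl⟩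
  refine (Finset.abs_sum_le_sum_abs _ _).trans (Finset.sum_le_sum fun idx _ => ?_)
  rw [abs_mul, Finset.abs_prod]
  refine mul_le_of_le_one_right (abs_nonneg _) (Finset.prod_le_one (fun _ _ => abs_nonneg _) ?_)
  intro k _
  simpa [hy] using PiLp.norm_apply_le y (idx k)

/-- inequality (2.9) of the paper. Let `p ≥ 3` be odd,
`T̂ = ∑ λᵢ vᵢ^⊗p + E` with `{vᵢ}` orthonormal, `λᵢ > 0`, `E` symmetric of operator norm
`ε`. Let `x̂` maximize `T̂ x^⊗p` over unit vectors, `xᵢ := ⟨vᵢ, x̂⟩`, and let `j` maximize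
`λᵢ |xᵢ|^{p−2}`. Then `‖∑_{i ≠ j} λᵢ xᵢ^{p−1} vᵢ‖₂ ≤ 4ε(1 + 2ε/λⱼ)`. -/
theorem sroa_residual_bound
    {n : ℕ} (p : ℕ) (hodd : Odd p) (hp : 3 ≤ p)
    (lam : Fin n → ℝ) (hlam : ∀ i, 0 < lam i)
    (v : Fin n → EuclideanSpace ℝ (Fin n)) (hv : Orthonormal ℝ v)
    (E : (Fin p → Fin n) → ℝ) (hE : tsymm E)
    (ε : ℝ) (hε : ε = tnorm E)
    (Th : (Fin p → Fin n) → ℝ) (hTh : Th = (∑ i, lam i • tpow p (v i)) + E)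
    (xh : EuclideanSpace ℝ (Fin n)) (hxh : ‖xh‖ = 1)
    (hmax : ∀ y : EuclideanSpace ℝ (Fin n), ‖y‖ = 1 → tapply Th y ≤ tapply Th xh)
    (j : Fin n)
    (hj : ∀ i, lam i * |⟪v i, xh⟫| ^ (p - 2) ≤ lam j * |⟪v j, xh⟫| ^ (p - 2)) :
    ‖∑ i ∈ Finset.univ.erase j, (lam i * ⟪v i, xh⟫ ^ (p - 1)) • v i‖ ≤
      4 * ε * (1 + 2 * ε / lam j) := by
  have hEx : ∀ y : EuclideanSpace ℝ (Fin n), ‖y‖ = 1 → |tapply E y| ≤ ε := fun y hy =>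
    hε ▸ abs_tapply_le_tnorm E hy
  have hTh_apply : ∀ y, tapply Th y = ∑ i, lam i * ⟪v i, y⟫ ^ p + tapply E y := fun y => by
    rw [hTh, tapply_add, tapply_sum_smul_tpow]
  have hbessel : ∑ i, ⟪v i, xh⟫ ^ 2 ≤ 1 := by
    simpa [hxh] using hv.sum_inner_products_le (s := Finset.univ) xh
  have hle_one : ∀ i, |⟪v i, xh⟫| ≤ 1 := fun i => by
    simpa [hxh, hv.1 i] using abs_real_inner_le_norm (v i) xh
  have hε0 : 0 ≤ ε := (abs_nonneg _).trans (hEx xh hxh)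
  set M := lam j * |⟪v j, xh⟫| ^ (p - 2) with hM
  have hM0 : 0 ≤ M := mul_nonneg (hlam j).le (by positivity)
  have hupper : tapply Th xh ≤ M + ε := by
    rw [hTh_apply]
    refine add_le_add ?_ (le_of_abs_le (hEx xh hxh))
    calc ∑ i, lam i * ⟪v i, xh⟫ ^ p ≤ ∑ i, M * ⟪v i, xh⟫ ^ 2 := by
          refine Finset.sum_le_sum fun i _ => ?_
          calc lam i * ⟪v i, xh⟫ ^ p ≤ lam i * |⟪v i, xh⟫| ^ p := by
                rw [← abs_pow]
                exact mul_le_mul_of_nonneg_left (le_abs_self _) (hlam i).le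
            _ = lam i * |⟪v i, xh⟫| ^ (p - 2) * ⟪v i, xh⟫ ^ 2 := by
                rw [← sq_abs ⟪v i, xh⟫, mul_assoc, ← pow_add, Nat.sub_add_cancel (by lia)]
            _ ≤ M * ⟪v i, xh⟫ ^ 2 := mul_le_mul_of_nonneg_right (hj i) (sq_nonneg _)
      _ = M * ∑ i, ⟪v i, xh⟫ ^ 2 := by rw [Finset.mul_sum]
      _ ≤ M := mul_le_of_le_one_right hM0 hbessel
  have hlower : ∀ i, lam i - ε ≤ tapply Th xh := fun i => by
    refine le_trans ?_ (hmax (v i) (hv.1 i))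
    have hsum : ∑ k, lam k * ⟪v k, v i⟫ ^ p = lam i := by
      simp [orthonormal_iff_ite.mp hv, ite_pow, show p ≠ 0 by lia]
    rw [hTh_apply, hsum]
    linarith [neg_le_of_abs_le (hEx (v i) (hv.1 i))]
  have hMj : M ≤ lam j * |⟪v j, xh⟫| :=
    mul_le_mul_of_nonneg_left
      (pow_le_of_le_one (abs_nonneg _) (hle_one j) (by lia)) (hlam j).le
  have hlam_le : ∀ i, lam i ≤ lam j + 2 * ε := fun i => by
    have := mul_le_of_le_one_right (hlam j).le (hle_one j)
    linarith [hlower i]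
  have hrest : ∑ i ∈ Finset.univ.erase j, ⟪v i, xh⟫ ^ 2 ≤ 4 * ε / lam j := by
    have hsplit := Finset.add_sum_erase Finset.univ (fun i => ⟪v i, xh⟫ ^ 2) (Finset.mem_univ j)
    have hgap : lam j * (1 - |⟪v j, xh⟫|) ≤ 2 * ε := by linarith [hlower j]
    rw [le_div_iff₀ (hlam j)]
    have hsq := sq_abs ⟪v j, xh⟫
    have hR : ∑ i ∈ Finset.univ.erase j, ⟪v i, xh⟫ ^ 2 ≤ 2 * (1 - |⟪v j, xh⟫|) := by
      nlinarith [sq_nonneg (1 - |⟪v j, xh⟫|)]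
    nlinarith [mul_le_mul_of_nonneg_right hR (hlam j).le]
  calc ‖∑ i ∈ Finset.univ.erase j, (lam i * ⟪v i, xh⟫ ^ (p - 1)) • v i‖
      ≤ ∑ i ∈ Finset.univ.erase j, (lam j + 2 * ε) * ⟪v i, xh⟫ ^ 2 := by
        refine (norm_sum_le _ _).trans (Finset.sum_le_sum fun i _ => ?_)
        rw [norm_smul, hv.1 i, mul_one, Real.norm_eq_abs, abs_mul, abs_of_pos (hlam i), abs_pow,
          ← sq_abs ⟪v i, xh⟫]
        exact mul_le_mul (hlam_le i)
          (pow_le_pow_of_le_one (abs_nonneg _) (hle_one i) (by lia)) (by positivity)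
          ((hlam i).le.trans (hlam_le i))
    _ = (lam j + 2 * ε) * ∑ i ∈ Finset.univ.erase j, ⟪v i, xh⟫ ^ 2 := by rw [Finset.mul_sum]
    _ ≤ (lam j + 2 * ε) * (4 * ε / lam j) :=
        mul_le_mul_of_nonneg_left hrest ((hlam j).le.trans (hlam_le j))
    _ = 4 * ε * (1 + 2 * ε / lam j) := by
        have := (hlam j).ne'
        field_simp
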